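/- For all sufficiently large primes p the following holds: setting L = ⌊0.1·log p⌋, there exists an integer c with L/4 < c < p − L/4 such that for every integer l with 1 ≤ l ≤ L, both Legendre symbols satisfy ((l − 4c)/p) = −1 and ((l + 4c)/p) = −1. -/

import Mathlib

open Polynomial

/-- The linear map `r ↦ rₖ` for which the `k`-th derivative of `f ^ n * r` is
`f ^ (n - k) * rₖ`. -/
noncomputable def derivTwist {F : Type*} [Field F] (f : F[X]) (n : ℕ) : ℕ → F[X] →ₗ[F] F[X]
  | 0 => LinearMap.id
  | k + 1 => (LinearMap.mulLeft F (((n - k : ℕ) : F[X]) * derivative f) +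
      LinearMap.mulLeft F f ∘ₗ derivative) ∘ₗ derivTwist f n k

section

variable {F : Type*} [Field F]

theorem derivTwist_succ (f : F[X]) (n k : ℕ) (r : F[X]) :
    derivTwist f n (k + 1) r = ((n - k : ℕ) : F[X]) * derivative f * derivTwist f n k r +
      f * derivative (derivTwist f n k r) := by
  simp [derivTwist, mul_assoc]

theorem iterate_derivative_pow_mul (f : F[X]) (n k : ℕ) (hk : k ≤ n) (r : F[X]) :
    derivative^[k] (f ^ n * r) = f ^ (n - k) * derivTwist f n k r := by
  induction k with
  | zero => simp [derivTwist]
  | succ k ih =>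
    rw [Function.iterate_succ_apply', ih (by omega), derivTwist_succ, derivative_mul,
      derivative_pow]
    obtain ⟨j, hj⟩ : ∃ j, n - k = j + 1 := ⟨n - k - 1, by omega⟩
    have h2 : n - (k + 1) = j := by omega
    rw [hj, h2, Nat.add_sub_cancel]
    push_cast
    simp
    ring

theorem natDegree_le_of_mem_degreeLT_succ {A : ℕ} {r : F[X]} (hr : r ∈ degreeLT F (A + 1)) :
    r.natDegree ≤ A := by
  rcases eq_or_ne r 0 with rfl | h
  · simp
  · rw [mem_degreeLT, ← natDegree_lt_iff_degree_lt h] at hr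
    omega

theorem natDegree_derivTwist_le (f : F[X]) (n k A : ℕ) (r : F[X]) (hr : r.natDegree ≤ A) :
    (derivTwist f n k r).natDegree ≤ A + k * f.natDegree := by
  induction k with
  | zero => simpa [derivTwist] using hr
  | succ k ih =>
    rw [derivTwist_succ]
    have hf := natDegree_derivative_le f
    have hd := natDegree_derivative_le (derivTwist f n k r)
    have h0 : (k + 1) * f.natDegree = k * f.natDegree + f.natDegree := by ring
    refine natDegree_add_le_of_degree_le ?_ ?_
    · refine natDegree_mul_le.trans ?_
      have := natDegree_mul_le (p := ((n - k : ℕ) : F[X])) (q := derivative f)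
      rw [natDegree_natCast] at this
      omega
    · refine natDegree_mul_le.trans ?_
      omega

theorem iterate_derivative_mul_X_pow_char (p : ℕ) [CharP F p] (k j : ℕ) (q : F[X]) :
    derivative^[k] (q * X ^ (j * p)) = derivative^[k] q * X ^ (j * p) := by
  induction k with
  | zero => simp
  | succ k ih =>
    rw [Function.iterate_succ_apply', ih, Function.iterate_succ_apply', derivative_mul,
      derivative_X_pow]
    simp

end

section

variable {p : ℕ} [Fact p.Prime]

theorem eq_zero_of_X_pow_dvd {h A : ℕ} (hp : p = 2 * h + 1) {f : (ZMod p)[X]} {u : ZMod p}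
    (hu : Odd (f.rootMultiplicity u)) (h0 : f.eval 0 ≠ 0) (hA : f.natDegree + 2 * A < p)
    {r s : (ZMod p)[X]} (hr : r.natDegree ≤ A) (hs : s.natDegree ≤ A)
    (hdvd : X ^ p ∣ r + f ^ h * s) : r = 0 ∧ s = 0 := by
  have hf : f ≠ 0 := by rintro rfl; simp at h0
  have h1 : X ^ p ∣ f * r ^ 2 - f ^ p * s ^ 2 := by
    have hfp : f ^ p = f ^ (2 * h + 1) := congrArg (f ^ ·) hp
    have : f * r ^ 2 - f ^ p * s ^ 2 = (r + f ^ h * s) * (f * (r - f ^ h * s)) := by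
      rw [hfp]; ring
    rw [this]
    exact hdvd.mul_right _
  have h2 : X ^ p ∣ f ^ p - C (f.eval 0) := by
    have : X ∣ f - C (f.eval 0) := by
      rw [X_dvd_iff]; simp [coeff_zero_eq_eval_zero]
    simpa only [expand_X, map_sub, expand_C, ZMod.expand_card] using
      map_dvd (expand (ZMod p) p) this
  have h3 : X ^ p ∣ f * r ^ 2 - C (f.eval 0) * s ^ 2 := by
    have := dvd_add h1 (h2.mul_right (s ^ 2))
    convert this using 1
    ring
  have h4 : f * r ^ 2 = C (f.eval 0) * s ^ 2 := by
    rw [← sub_eq_zero]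
    refine eq_zero_of_dvd_of_natDegree_lt h3 ?_
    rw [natDegree_X_pow]
    refine lt_of_le_of_lt ?_ hA
    refine (natDegree_sub_le _ _).trans (max_le ?_ ?_)
    · refine natDegree_mul_le.trans ?_
      have := natDegree_pow_le (p := r) (n := 2)
      omega
    · refine (natDegree_C_mul_le _ _).trans ?_
      have := natDegree_pow_le (p := s) (n := 2)
      omega
  have hc : C (f.eval 0) ≠ 0 := by simpa using h0
  by_cases hr0 : r = 0
  · refine ⟨hr0, ?_⟩
    rw [hr0] at h4
    simpa [hc, h0] using h4.symm
  · exfalso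
    have hs0 : s ≠ 0 := by
      rintro rfl
      simp [hf, hr0] at h4
    have h5 := congrArg (rootMultiplicity u) h4
    have h6 : f * r ^ 2 ≠ 0 := mul_ne_zero hf (pow_ne_zero _ hr0)
    rw [rootMultiplicity_mul h6, rootMultiplicity_mul (h4 ▸ h6), rootMultiplicity_C] at h5
    rw [pow_two, pow_two, rootMultiplicity_mul (mul_ne_zero hr0 hr0),
      rootMultiplicity_mul (mul_ne_zero hs0 hs0)] at h5
    obtain ⟨w, hw⟩ := hu
    omega

theorem eq_zero_of_sum_mul_X_pow_eq_zero {h A : ℕ} (hp : p = 2 * h + 1) {f : (ZMod p)[X]}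
    {u : ZMod p} (hu : Odd (f.rootMultiplicity u)) (h0 : f.eval 0 ≠ 0)
    (hA : f.natDegree + 2 * A < p) (J : ℕ) (r s : Fin J → (ZMod p)[X])
    (hr : ∀ j, (r j).natDegree ≤ A) (hs : ∀ j, (s j).natDegree ≤ A)
    (hsum : ∑ j : Fin J, (r j + f ^ h * s j) * X ^ (j * p) = 0) (j : Fin J) :
    r j = 0 ∧ s j = 0 := by
  induction J with
  | zero => exact j.elim0
  | succ J ih =>
    rw [Fin.sum_univ_succ] at hsum
    have h1 : ∑ j : Fin J, (r j.succ + f ^ h * s j.succ) * X ^ ((j.succ : ℕ) * p) =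
        X ^ p * ∑ j : Fin J, (r j.succ + f ^ h * s j.succ) * X ^ ((j : ℕ) * p) := by
      rw [Finset.mul_sum]
      refine Finset.sum_congr rfl fun j _ => ?_
      rw [Fin.val_succ, Nat.succ_mul, pow_add]
      ring
    rw [h1] at hsum
    have h2 : r 0 = 0 ∧ s 0 = 0 := by
      refine eq_zero_of_X_pow_dvd hp hu h0 hA (hr 0) (hs 0) ?_
      rw [Fin.val_zero, zero_mul, pow_zero, mul_one] at hsum
      rw [eq_neg_of_add_eq_zero_left hsum]
      exact (dvd_mul_right _ _).neg_right
    rw [h2.1, h2.2] at hsum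
    simp only [mul_zero, add_zero, zero_mul, zero_add, mul_eq_zero, pow_eq_zero_iff', X_ne_zero,
      false_and, false_or] at hsum
    refine Fin.cases h2 (fun i => ?_) j
    exact ih (fun i => r i.succ) (fun i => s i.succ) (fun i => hr _) (fun i => hs _) hsum i

/-- The Stepanov auxiliary polynomial: it vanishes to order `M` wherever `f ^ h` takes the value `a`. -/
theorem exists_auxiliary_polynomial {h A J M : ℕ} (hp : p = 2 * h + 1) {f : (ZMod p)[X]}
    {u : ZMod p} (hu : Odd (f.rootMultiplicity u)) (h0 : f.eval 0 ≠ 0)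
    (hA : f.natDegree + 2 * A < p)
    (hdim : M * (A + M * f.natDegree + J) < 2 * J * (A + 1)) (a : ZMod p) :
    ∃ R : (ZMod p)[X], R ≠ 0 ∧
      R.natDegree ≤ M * f.natDegree + h * f.natDegree + A + J * p ∧
      ∀ x, f.eval x ^ h = a → ∀ k < M, (derivative^[k] R).eval x = 0 := by
  classical
  let V := Fin J → (degreeLT (ZMod p) (A + 1) × degreeLT (ZMod p) (A + 1))
  let P (k : ℕ) : V →ₗ[ZMod p] (ZMod p)[X] :=
    ∑ j : Fin J, LinearMap.mulLeft (ZMod p) (X ^ (j : ℕ)) ∘ₗ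
      (derivTwist f M k ∘ₗ Submodule.subtype _ ∘ₗ LinearMap.fst _ _ _ +
        LinearMap.mulLeft (ZMod p) (C a) ∘ₗ derivTwist f (M + h) k ∘ₗ Submodule.subtype _ ∘ₗ
          LinearMap.snd _ _ _) ∘ₗ LinearMap.proj j
  have hP (k : ℕ) (v : V) : P k v = ∑ j : Fin J, X ^ (j : ℕ) *
      (derivTwist f M k (v j).1 + C a * derivTwist f (M + h) k (v j).2) := by
    simp only [P, LinearMap.sum_apply]
    rfl
  let B := A + M * f.natDegree + J
  let Φ : V →ₗ[ZMod p] (Fin M → Fin B → ZMod p) :=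
    LinearMap.pi fun k => LinearMap.pi fun i => lcoeff (ZMod p) i ∘ₗ P k
  have hker : LinearMap.ker Φ ≠ ⊥ := by
    refine LinearMap.ker_ne_bot_of_finrank_lt ?_
    have e := (degreeLTEquiv (ZMod p) (A + 1)).finrank_eq
    simp [V, Module.finrank_pi_fintype, e, B]
    linarith
  obtain ⟨v, hv, hv0⟩ := (Submodule.ne_bot_iff _).1 hker
  have hdeg1 (j : Fin J) : ((v j).1 : (ZMod p)[X]).natDegree ≤ A :=
    natDegree_le_of_mem_degreeLT_succ (v j).1.2
  have hdeg2 (j : Fin J) : ((v j).2 : (ZMod p)[X]).natDegree ≤ A :=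
    natDegree_le_of_mem_degreeLT_succ (v j).2.2
  have hPv (k : ℕ) (hk : k < M) : P k v = 0 := by
    ext i
    by_cases hi : i < B
    · have := congrFun (congrFun (LinearMap.mem_ker.1 hv) ⟨k, hk⟩) ⟨i, hi⟩
      simpa [Φ] using this
    · rw [coeff_zero]
      refine coeff_eq_zero_of_natDegree_lt (lt_of_lt_of_le ?_ (not_lt.1 hi))
      have hJ : 0 < J := Nat.pos_of_ne_zero (by rintro rfl; simp at hdim)
      have hkM : k * f.natDegree ≤ M * f.natDegree := Nat.mul_le_mul_right _ hk.le
      have : (P k v).natDegree ≤ J - 1 + (A + M * f.natDegree) := by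
        rw [hP]
        refine natDegree_sum_le_of_forall_le _ _ fun j _ => natDegree_mul_le.trans ?_
        rw [natDegree_X_pow]
        refine add_le_add (by omega) (natDegree_add_le_of_degree_le ?_ ?_)
        · exact (natDegree_derivTwist_le f M k A _ (hdeg1 j)).trans (by omega)
        · exact (natDegree_C_mul_le _ _).trans
            ((natDegree_derivTwist_le f (M + h) k A _ (hdeg2 j)).trans (by omega))
      omega
  refine ⟨f ^ M * ∑ j : Fin J, ((v j).1.1 + f ^ h * (v j).2.1) * X ^ (j * p), ?_, ?_, ?_⟩
  · have hf : f ≠ 0 := by rintro rfl; simp at h0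
    refine mul_ne_zero (pow_ne_zero _ hf) fun hsum => hv0 ?_
    have := eq_zero_of_sum_mul_X_pow_eq_zero hp hu h0 hA J (fun j => (v j).1)
      (fun j => (v j).2) hdeg1 hdeg2 hsum
    funext j
    ext1
    · exact Subtype.ext (this j).1
    · exact Subtype.ext (this j).2
  · refine natDegree_mul_le.trans ?_
    rw [add_assoc, add_assoc]
    refine add_le_add natDegree_pow_le (natDegree_sum_le_of_forall_le _ _ fun j _ => ?_)
    refine natDegree_mul_le.trans ?_
    rw [natDegree_X_pow, ← add_assoc]
    refine add_le_add (natDegree_add_le_of_degree_le ?_ ?_) (Nat.mul_le_mul_right _ j.2.le)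
    · exact (hdeg1 j).trans (by omega)
    · exact natDegree_mul_le.trans (add_le_add natDegree_pow_le (hdeg2 j))
  · intro x hx k hk
    have hR : f ^ M * ∑ j : Fin J, ((v j).1.1 + f ^ h * (v j).2.1) * X ^ (j * p) =
        ∑ j : Fin J, (f ^ M * (v j).1.1 + f ^ (M + h) * (v j).2.1) * X ^ (j * p) := by
      rw [Finset.mul_sum]
      refine Finset.sum_congr rfl fun j _ => ?_
      rw [pow_add]
      ring
    have h1 : (f.eval x) ^ (M - k) * (P k v).eval x = 0 := by simp [hPv k hk]
    rw [hR, iterate_derivative_sum, eval_finsetSum, ← h1, hP, eval_finsetSum, Finset.mul_sum]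
    refine Finset.sum_congr rfl fun j _ => ?_
    rw [iterate_derivative_mul_X_pow_char, iterate_map_add,
      iterate_derivative_pow_mul f M k hk.le,
      iterate_derivative_pow_mul f (M + h) k (by omega)]
    have h3 : M + h - k = M - k + h := by omega
    simp only [eval_mul, eval_add, eval_pow, eval_X, eval_C, h3, pow_add, hx, mul_comm (j : ℕ) p,
      pow_mul, ZMod.pow_card]
    ring

theorem mul_card_le_natDegree {M : ℕ} (hM : M < p) {R : (ZMod p)[X]} (hR : R ≠ 0)
    (S : Finset (ZMod p)) (hS : ∀ x ∈ S, ∀ k < M, (derivative^[k] R).eval x = 0) :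
    M * S.card ≤ R.natDegree := by
  classical
  rcases Nat.eq_zero_or_pos M with rfl | hM0
  · simp
  have hle : M • S.val ≤ R.roots := by
    refine Multiset.le_iff_count.2 fun x => ?_
    rw [Multiset.count_nsmul, count_roots]
    by_cases hx : x ∈ S
    · rw [Multiset.count_eq_one_of_mem S.nodup hx, mul_one]
      have := lt_rootMultiplicity_of_isRoot_iterate_derivative_of_mem_nonZeroDivisors
        (n := M - 1) hR (fun k hk => hS x hx k (by omega))
        (mem_nonZeroDivisors_of_ne_zero ?_)
      · omega
      · rw [Ne, ZMod.natCast_eq_zero_iff, (Fact.out : p.Prime).dvd_factorial]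
        omega
    · rw [Multiset.count_eq_zero_of_notMem hx, mul_zero]
      exact Nat.zero_le _
  simpa using (Multiset.card_le_card hle).trans (card_roots' R)

theorem card_eval_pow_eq_le {h m : ℕ} (hp : p = 2 * h + 1) {f : (ZMod p)[X]}
    {u : ZMod p} (hu : Odd (f.rootMultiplicity u)) (h0 : f.eval 0 ≠ 0)
    (hd : 1 ≤ f.natDegree) (hm : 4 * m ^ 2 ≤ p) (hdm : 2 * f.natDegree + 4 * m ≤ p)
    (a : ZMod p) :
    2 * m * (Finset.univ.filter fun x => f.eval x ^ h = a).card ≤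
      m * p + 6 * f.natDegree * p := by
  set d := f.natDegree with hdd
  obtain ⟨A, hA1, hA2⟩ : ∃ A, d + 2 * A < p ∧ p ≤ d + 2 * A + 2 :=
    ⟨(p - d - 1) / 2, by omega, by omega⟩
  have hdim : 2 * m * (A + 2 * m * d + (m + 2 * d + 2)) < 2 * (m + 2 * d + 2) * (A + 1) := by
    have h1 : p + 4 * m ≤ 4 * (A + 1) := by omega
    nlinarith [Nat.mul_le_mul_left (2 * d + 2) h1, Nat.mul_le_mul_left (2 * d + 1) hm]
  obtain ⟨R, hR, hdeg, hroot⟩ := exists_auxiliary_polynomial hp hu h0 hA1 hdim a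
  have h2 := mul_card_le_natDegree (by omega) hR
    (Finset.univ.filter fun x => f.eval x ^ h = a) fun x hx => hroot x (by simpa using hx)
  refine (h2.trans hdeg).trans ?_
  rw [← hdd]
  nlinarith [Nat.mul_le_mul_right d hdm, Nat.mul_le_mul_right p hd]

/-- A weak form of the Weil bound for sums of the quadratic character over polynomial values. -/
theorem abs_sum_quadraticChar_le {m : ℕ} (hp : p ≠ 2) {f : (ZMod p)[X]}
    {u : ZMod p} (hu : Odd (f.rootMultiplicity u)) (h0 : f.eval 0 ≠ 0)
    (hd : 1 ≤ f.natDegree) (hm : 4 * m ^ 2 ≤ p) (hdm : 2 * f.natDegree + 4 * m ≤ p) :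
    m * |∑ x : ZMod p, quadraticChar (ZMod p) (f.eval x)| ≤ 7 * f.natDegree * p := by
  obtain ⟨h, hh⟩ : ∃ h, p = 2 * h + 1 := (Fact.out : p.Prime).odd_of_ne_two hp
  have hdiv : p / 2 = h := by omega
  have hchar (y : ZMod p) : ((quadraticChar (ZMod p) y : ℤ) : ZMod p) = y ^ h := by
    have := quadraticChar_eq_pow_of_char_ne_two' (F := ZMod p) (by rwa [ZMod.ringChar_zmod_n]) y
    rwa [ZMod.card, hdiv] at this
  let S (a : ℤ) := Finset.univ.filter fun x : ZMod p => quadraticChar (ZMod p) (f.eval x) = a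
  have hS (a : ℤ) : 2 * m * (S a).card ≤ m * p + 6 * f.natDegree * p := by
    refine le_trans (Nat.mul_le_mul_left _ (Finset.card_le_card fun x hx => ?_))
      (card_eval_pow_eq_le hh hu h0 hd hm hdm (a : ZMod p))
    simp only [S, Finset.mem_filter, Finset.mem_univ, true_and] at hx ⊢
    rw [← hchar, hx]
  have hS0 : (S 0).card ≤ f.natDegree := by
    have hf : f ≠ 0 := by rintro rfl; simp at h0
    refine le_trans (Finset.card_le_card (t := f.roots.toFinset) fun x hx => ?_)
      ((Multiset.toFinset_card_le _).trans (card_roots' f))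
    have hx' : quadraticChar (ZMod p) (f.eval x) = 0 := by simpa only [S, Finset.mem_filter,
      Finset.mem_univ, true_and] using hx
    rw [Multiset.mem_toFinset, mem_roots hf]
    exact quadraticChar_eq_zero_iff.1 hx'
  have hval (x : ZMod p) : quadraticChar (ZMod p) (f.eval x) = 0 ∨
      quadraticChar (ZMod p) (f.eval x) = 1 ∨ quadraticChar (ZMod p) (f.eval x) = -1 := by
    by_cases hx : f.eval x = 0
    · simp [hx]
    · exact Or.inr (quadraticChar_dichotomy hx)
  have hsum : ∑ x : ZMod p, quadraticChar (ZMod p) (f.eval x) = (S 1).card - (S (-1)).card := by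
    simp only [S, Finset.card_filter]
    push_cast
    rw [← Finset.sum_sub_distrib]
    refine Finset.sum_congr rfl fun x _ => ?_
    rcases hval x with h | h | h <;> simp [h]
  have htot : (p : ℤ) = (S 0).card + (S 1).card + (S (-1)).card := by
    have : (p : ℤ) = ∑ x : ZMod p, 1 := by simp
    rw [this]
    simp only [S, Finset.card_filter]
    push_cast
    rw [← Finset.sum_add_distrib, ← Finset.sum_add_distrib]
    refine Finset.sum_congr rfl fun x _ => ?_
    rcases hval x with h | h | h <;> simp [h]
  have hmp : m ≤ p := by omega
  have hmd : (m : ℤ) * (S 0).card ≤ p * f.natDegree := by exact_mod_cast Nat.mul_le_mul hmp hS0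
  have h1 : (2 : ℤ) * m * (S 1).card ≤ m * p + 6 * f.natDegree * p := by exact_mod_cast hS 1
  have h2 : (2 : ℤ) * m * (S (-1)).card ≤ m * p + 6 * f.natDegree * p := by
    exact_mod_cast hS (-1)
  have h3 : (m : ℤ) * p = m * (S 0).card + m * (S 1).card + m * (S (-1)).card := by
    rw [htot]; ring
  rw [hsum, ← Nat.abs_cast m, ← abs_mul, abs_le]
  constructor <;> nlinarith

theorem exists_quadraticChar_sub_eq (hp : 2 ^ 24 ≤ p) {T : Finset (ZMod p)} (h0 : 0 ∉ T)
    (hT : 2 ^ (7 * T.card) ≤ p) (ε : ZMod p → ℤ) (hε : ∀ t ∈ T, ε t = 1 ∨ ε t = -1) :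
    ∃ x, ∀ t ∈ T, quadraticChar (ZMod p) (x - t) = ε t := by
  classical
  by_contra! hcon
  set k := T.card with hk
  obtain ⟨m, hm1, hm2⟩ : ∃ m, 4 * m ^ 2 ≤ p ∧ p < 4 * (m + 1) ^ 2 := by
    refine ⟨Nat.sqrt (p / 4), ?_, ?_⟩
    · have := Nat.sqrt_le' (p / 4)
      omega
    · have := Nat.lt_succ_sqrt' (p / 4)
      rw [Nat.succ_eq_add_one] at this
      omega
  have hk2 : k < 2 ^ k := Nat.lt_two_pow_self
  have hkp : 4 * k ≤ p := by
    refine le_trans ?_ hT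
    rcases Nat.eq_zero_or_pos k with h | h
    · simp [h]
    · calc 4 * k ≤ 2 ^ 2 * 2 ^ k := by omega
        _ = 2 ^ (2 + k) := (pow_add _ _ _).symm
        _ ≤ 2 ^ (7 * k) := Nat.pow_le_pow_right (by norm_num) (by omega)
  have hmp : 8 * m ≤ p := by nlinarith
  have habs (S : Finset (ZMod p)) (hS : S ⊆ T) (hne : S.Nonempty) :
      m * |∑ x : ZMod p, ∏ t ∈ S, quadraticChar (ZMod p) (x - t)| ≤ 7 * k * p := by
    obtain ⟨u, hu⟩ := hne
    have hroots : (∏ t ∈ S, (X - C t)).roots = S.val := roots_prod_X_sub_C S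
    have hdeg : (∏ t ∈ S, (X - C t)).natDegree = S.card := by simp
    have hcard : S.card ≤ k := Finset.card_le_card hS
    have := abs_sum_quadraticChar_le (p := p) (m := m) (by omega) (f := ∏ t ∈ S, (X - C t)) (u := u)
      (by rw [← count_roots, hroots, Multiset.count_eq_one_of_mem S.nodup hu]; exact odd_one)
      (by
        rw [eval_prod, Finset.prod_ne_zero_iff]
        intro t ht
        rw [eval_sub, eval_X, eval_C, zero_sub, neg_ne_zero]
        rintro rfl
        exact h0 (hS ht))
      (by rw [hdeg]; exact Finset.card_pos.2 ⟨u, hu⟩) hm1 (by rw [hdeg]; omega)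
    simp only [eval_prod, eval_sub, eval_X, eval_C, map_prod, hdeg] at this
    refine this.trans ?_
    gcongr
  let Q (x : ZMod p) : ℤ := ∏ t ∈ T, (1 + ε t * quadraticChar (ZMod p) (x - t))
  have hfac (x t : ZMod p) (ht : t ∈ T) : 0 ≤ 1 + ε t * quadraticChar (ZMod p) (x - t) ∧
      1 + ε t * quadraticChar (ZMod p) (x - t) ≤ 2 ∧
      (x ≠ t → quadraticChar (ZMod p) (x - t) ≠ ε t →
        1 + ε t * quadraticChar (ZMod p) (x - t) = 0) := by
    by_cases hx : x = t
    · simp [hx]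
    · rcases quadraticChar_dichotomy (sub_ne_zero.2 hx) with h | h <;>
        rcases hε t ht with h' | h' <;> rw [h, h'] <;> norm_num
  have hQ (x : ZMod p) : Q x ≤ if x ∈ T then 2 ^ k else 0 := by
    split_ifs with hx
    · exact (Finset.prod_le_prod (fun t ht => (hfac x t ht).1)
        (fun t ht => (hfac x t ht).2.1)).trans (by rw [Finset.prod_const])
    · obtain ⟨t, ht, hne⟩ := hcon x
      exact (Finset.prod_eq_zero ht ((hfac x t ht).2.2 (by rintro rfl; exact hx ht) hne)).le
  have hup : ∑ x, Q x ≤ k * 2 ^ k := by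
    refine (Finset.sum_le_sum fun x _ => hQ x).trans ?_
    rw [Finset.sum_ite_mem, Finset.univ_inter, Finset.sum_const, nsmul_eq_mul]
  have hexp : ∑ x, Q x = ∑ S ∈ T.powerset, (∏ t ∈ S, ε t) *
      ∑ x : ZMod p, ∏ t ∈ S, quadraticChar (ZMod p) (x - t) := by
    simp only [Q, Finset.prod_one_add, Finset.prod_mul_distrib]
    rw [Finset.sum_comm]
    simp only [Finset.mul_sum]
  have hεprod (S : Finset (ZMod p)) (hS : S ⊆ T) : |∏ t ∈ S, ε t| = 1 := by
    rw [Finset.abs_prod]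
    refine Finset.prod_eq_one fun t ht => ?_
    rcases hε t (hS ht) with h | h <;> simp [h]
  have hlow : (m : ℤ) * p - 2 ^ k * (7 * k * p) ≤ m * ∑ x, Q x := by
    have h1 : -(2 ^ k * (7 * k * p) : ℤ) ≤ m * ∑ S ∈ T.powerset.erase ∅, (∏ t ∈ S, ε t) *
        ∑ x : ZMod p, ∏ t ∈ S, quadraticChar (ZMod p) (x - t) := by
      rw [Finset.mul_sum]
      refine le_trans ?_ (neg_abs_le _)
      rw [neg_le_neg_iff]
      refine (Finset.abs_sum_le_sum_abs _ _).trans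
        ((Finset.sum_le_card_nsmul _ _ (7 * k * p : ℤ) fun S hS => ?_).trans ?_)
      · rw [Finset.mem_erase, Finset.mem_powerset] at hS
        rw [abs_mul, abs_mul, hεprod S hS.2, one_mul, Nat.abs_cast]
        exact habs S hS.2 (Finset.nonempty_iff_ne_empty.2 hS.1)
      · rw [nsmul_eq_mul]
        refine mul_le_mul_of_nonneg_right ?_ (by positivity)
        have := Finset.card_le_card (Finset.erase_subset ∅ T.powerset)
        rw [Finset.card_powerset] at this
        exact_mod_cast this
    have h2 : (∏ t ∈ (∅ : Finset (ZMod p)), ε t) *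
        ∑ x : ZMod p, ∏ t ∈ (∅ : Finset (ZMod p)), quadraticChar (ZMod p) (x - t) = p := by simp
    have h3 := Finset.add_sum_erase T.powerset (fun S => (∏ t ∈ S, ε t) *
      ∑ x : ZMod p, ∏ t ∈ S, quadraticChar (ZMod p) (x - t)) (Finset.empty_mem_powerset T)
    simp only [h2] at h3
    rw [hexp, ← h3, mul_add]
    linarith
  have hm8 : m ≤ 8 * k * 2 ^ k := by
    have h1 : (m : ℤ) * p ≤ 8 * k * 2 ^ k * p := by
      have h2 := mul_le_mul_of_nonneg_left hup (Int.natCast_nonneg m)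
      have h3 : (m : ℤ) * (k * 2 ^ k) ≤ p * (k * 2 ^ k) := by
        refine mul_le_mul_of_nonneg_right ?_ (by positivity)
        exact_mod_cast (by omega : m ≤ p)
      linarith
    have h4 : (0 : ℤ) < p := by exact_mod_cast (by omega : 0 < p)
    exact_mod_cast le_of_mul_le_mul_right h1 h4
  have hm9 : m ≤ 8 * 2 ^ (2 * k) := by
    refine hm8.trans ?_
    rw [two_mul k, pow_add, ← mul_assoc]
    gcongr
  have hm0 : 1 ≤ m := by
    by_contra! h
    have : m = 0 := by omega
    subst this
    omega
  have hp1 : p < 2 ^ 10 * 2 ^ (4 * k) := by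
    have : (2 : ℕ) ^ (4 * k) = 2 ^ (2 * k) * 2 ^ (2 * k) := by rw [← pow_add]; congr 1; ring
    rw [this]
    nlinarith [Nat.mul_le_mul hm9 hm9]
  have h7 : p ^ 7 < 2 ^ 70 * p ^ 4 := by
    calc p ^ 7 < (2 ^ 10 * 2 ^ (4 * k)) ^ 7 := Nat.pow_lt_pow_left hp1 (by norm_num)
      _ = 2 ^ 70 * (2 ^ (7 * k)) ^ 4 := by ring
      _ ≤ 2 ^ 70 * p ^ 4 := by gcongr
  have h3 : (2 ^ 24) ^ 3 ≤ p ^ 3 := Nat.pow_le_pow_left hp 3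
  have h8 : p ^ 7 = p ^ 3 * p ^ 4 := by ring
  rw [h8] at h7
  have := lt_of_mul_lt_mul_right h7 (Nat.zero_le _)
  omega

/-- Some `x` makes `l - x` and `l + x` nonresidues for all `1 ≤ l ≤ L`. -/
theorem exists_quadraticChar_add_sub_eq_neg_one (hp : 2 ^ 24 ≤ p) {L : ℕ} (hL : 2 ^ (14 * L) ≤ p) :
    ∃ x : ZMod p, ∀ l : ℕ, 1 ≤ l → l ≤ L →
      quadraticChar (ZMod p) (l - x) = -1 ∧ quadraticChar (ZMod p) (l + x) = -1 := by
  classical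
  have hLp : 2 * L < p := by
    refine lt_of_lt_of_le (b := 2 ^ (2 * L)) Nat.lt_two_pow_self (le_trans ?_ hL)
    exact Nat.pow_le_pow_right (by norm_num) (by omega)
  have hne (n : ℕ) (h1 : 1 ≤ n) (h2 : n ≤ 2 * L) : (n : ZMod p) ≠ 0 := by
    rw [Ne, ZMod.natCast_eq_zero_iff]
    exact fun h => absurd (Nat.le_of_dvd h1 h) (by omega)
  let T₁ := (Finset.Icc 1 L).image fun l : ℕ => (l : ZMod p)
  let T₂ := (Finset.Icc 1 L).image fun l : ℕ => -(l : ZMod p)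
  have hcard : (T₁ ∪ T₂).card ≤ 2 * L := by
    have h1 : T₁.card ≤ L := Finset.card_image_le.trans (by simp)
    have h2 : T₂.card ≤ L := Finset.card_image_le.trans (by simp)
    have := Finset.card_union_le T₁ T₂
    omega
  have hχ : quadraticChar (ZMod p) (-1) = 1 ∨ quadraticChar (ZMod p) (-1) = -1 :=
    quadraticChar_dichotomy (neg_ne_zero.2 one_ne_zero)
  obtain ⟨x, hx⟩ := exists_quadraticChar_sub_eq hp (T := T₁ ∪ T₂)
    (by
      simp only [T₁, T₂, Finset.mem_union, Finset.mem_image, Finset.mem_Icc, neg_eq_zero]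
      rintro (⟨l, hl, h⟩ | ⟨l, hl, h⟩) <;> exact hne l hl.1 (by omega) h)
    ((Nat.pow_le_pow_right (by norm_num) (by omega)).trans hL)
    (fun t => if t ∈ T₁ then -quadraticChar (ZMod p) (-1) else -1)
    (fun t _ => by split_ifs <;> rcases hχ with h | h <;> simp [h])
  refine ⟨x, fun l h1 h2 => ⟨?_, ?_⟩⟩
  · have hl : (l : ZMod p) ∈ T₁ := Finset.mem_image_of_mem _ (Finset.mem_Icc.2 ⟨h1, h2⟩)
    have h := hx l (Finset.mem_union_left _ hl)
    rw [if_pos hl] at h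
    rw [← neg_sub, neg_eq_neg_one_mul, map_mul, h]
    rcases hχ with h | h <;> simp [h]
  · have hl : -(l : ZMod p) ∈ T₂ :=
      Finset.mem_image_of_mem (fun l : ℕ => -(l : ZMod p)) (Finset.mem_Icc.2 ⟨h1, h2⟩)
    have hl' : -(l : ZMod p) ∉ T₁ := by
      simp only [T₁, Finset.mem_image, Finset.mem_Icc, not_exists, not_and]
      intro l' hl' h
      refine hne (l' + l) (by omega) (by omega) ?_
      rw [Nat.cast_add, h, neg_add_cancel]
    have h := hx _ (Finset.mem_union_right _ hl)
    rwa [if_neg hl', sub_neg_eq_add, add_comm] at h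

end

theorem two_pow_le_of_le_log {p L : ℕ} (hp : 0 < p) (hL : (L : ℝ) ≤ 0.1 * Real.log p) :
    2 ^ (14 * L) ≤ p := by
  have h0 : (0 : ℝ) < p := by exact_mod_cast hp
  have h : (2 : ℝ) ^ (14 * L) ≤ p := by
    rw [← Real.log_le_log_iff (by positivity) h0, Real.log_pow]
    push_cast
    have h2 := Real.log_two_lt_d9
    have h3 : (0 : ℝ) ≤ L := Nat.cast_nonneg L
    nlinarith
  exact_mod_cast h

/-- For all sufficiently large primes `p`, with `L = ⌊0.1 log p⌋`, there is an integer `c`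
with `L/4 < c < p - L/4` such that `((l - 4c)/p) = ((l + 4c)/p) = -1` for all `1 ≤ l ≤ L`. -/
theorem exists_c_all_legendre_neg_one :
    ∃ N : ℕ, ∀ (p : ℕ) [Fact p.Prime], N ≤ p →
      ∃ c : ℤ, ((⌊0.1 * Real.log p⌋ : ℝ) / 4 < (c : ℝ)) ∧
        ((c : ℝ) < (p : ℝ) - (⌊0.1 * Real.log p⌋ : ℝ) / 4) ∧
        ∀ l : ℤ, 1 ≤ l → l ≤ ⌊0.1 * Real.log p⌋ →
          legendreSym p (l - 4 * c) = -1 ∧ legendreSym p (l + 4 * c) = -1 := by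
  refine ⟨2 ^ 24, fun p _ hp => ?_⟩
  have hlog : (10 : ℝ) ≤ Real.log p := by
    have h1 : Real.log (2 ^ 24) ≤ Real.log p :=
      Real.log_le_log (by positivity) (by exact_mod_cast hp)
    rw [Real.log_pow] at h1
    have h2 := Real.log_two_gt_d9
    norm_num at h1
    linarith
  have hL1 : 1 ≤ ⌊0.1 * Real.log p⌋ := Int.le_floor.2 (by push_cast; linarith)
  obtain ⟨L, hL⟩ := Int.eq_ofNat_of_zero_le (by omega : 0 ≤ ⌊0.1 * Real.log p⌋)
  have hLlog : (L : ℝ) ≤ 0.1 * Real.log p := by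
    have := Int.floor_le (0.1 * Real.log p)
    rw [hL] at this
    exact_mod_cast this
  obtain ⟨x, hx⟩ := exists_quadraticChar_add_sub_eq_neg_one hp (two_pow_le_of_le_log (by omega) hLlog)
  rw [hL] at hL1 ⊢
  have h4 : (4 : ZMod p) ≠ 0 := by
    have : ((4 : ℕ) : ZMod p) ≠ 0 := by
      rw [Ne, ZMod.natCast_eq_zero_iff]
      exact fun h => absurd (Nat.le_of_dvd (by norm_num) h) (by omega)
    exact_mod_cast this
  obtain ⟨c, hcp, hc⟩ : ∃ c : ℕ, c < p ∧ 4 * (c : ZMod p) = x :=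
    ⟨(x / 4).val, ZMod.val_lt _, by rw [ZMod.natCast_zmod_val, mul_div_cancel₀ _ h4]⟩
  have hsym (l : ℤ) (h1 : 1 ≤ l) (h2 : l ≤ L) :
      legendreSym p (l - 4 * c) = -1 ∧ legendreSym p (l + 4 * c) = -1 := by
    obtain ⟨l, rfl⟩ := Int.eq_ofNat_of_zero_le (by omega : 0 ≤ l)
    have := hx l (by omega) (by omega)
    rw [← hc] at this
    simpa only [legendreSym, Int.cast_sub, Int.cast_add, Int.cast_mul, Int.cast_natCast,
      Int.cast_ofNat] using this
  have hc0 : c ≠ 0 := by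
    rintro rfl
    have := (hsym 1 le_rfl hL1).1
    simp at this
  have hlow : L < 4 * c := by
    by_contra! h
    have := (hsym (4 * c) (by omega) (by omega)).1
    simp at this
  have hup : 4 * c + L < 4 * p := by
    by_contra! h
    have := (hsym (4 * (p - c)) (by omega) (by omega)).2
    simp [legendreSym, mul_sub] at this
  refine ⟨c, ?_, ?_, hsym⟩
  · have : (L : ℝ) < 4 * c := by exact_mod_cast hlow
    push_cast
    linarith
  · have : (4 : ℝ) * c + L < 4 * p := by exact_mod_cast hup
    push_cast
    linarith
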